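/- Let $A$ be an associative $K$-algebra and let $C$ be a Cartan subalgebra of the associated Lie algebra $A^{\circ}$. Then $C$ is closed under the associative multiplication of $A$, i.e. $C$ is an associative $K$-subalgebra of $A$; if moreover $A$ is unital, then $1_A \in C$, so $C$ is a unital associative subalgebra of $A$. -/

import Mathlib

open scoped TensorProduct

universe u

section

variable (K : Type u) (A : Type u) [Field K] [NonUnitalRing A] [Module K A]
  [SMulCommClass K A A] [IsScalarTower K A A]

/-- The Lie ring `A°` associated to a (possibly non-unital) associative ring `A`:
the commutator bracket `⁅a, b⁆ = a * b - b * a`. -/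
instance associatedLieRing : LieRing A where
  bracket a b := a * b - b * a
  add_lie a b c := by simp only [add_mul, mul_add]; abel
  lie_add a b c := by simp only [add_mul, mul_add]; abel
  lie_self a := by simp
  leibniz_lie a b c := by simp only [mul_sub, sub_mul, mul_assoc]; abel

/-- The Lie algebra `A°` associated to a (possibly non-unital) associative `K`-algebra `A`. -/
instance associatedLieAlgebra : LieAlgebra K A where
  lie_smul t a b := by
    show a * (t • b) - (t • b) * a = t • (a * b - b * a)
    rw [mul_smul_comm, smul_mul_assoc, smul_sub]

variable {K A} in
/-- The upper central series of `A°`, as a module over a Lie subalgebra acting by derivations,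
is multiplicative. -/
theorem mul_mem_ucs_bot_add (C : LieSubalgebra K A) (i j : ℕ) {a b : A}
    (ha : a ∈ (⊥ : LieSubmodule K C A).ucs i) (hb : b ∈ (⊥ : LieSubmodule K C A).ucs j) :
    a * b ∈ (⊥ : LieSubmodule K C A).ucs (i + j) := by
  induction h : i + j generalizing i j a b with
  | zero =>
    obtain ⟨rfl, rfl⟩ : i = 0 ∧ j = 0 := by omega
    simp_all
  | succ n ih =>
    obtain _ | i := i
    · obtain rfl : a = 0 := by simpa using ha
      simp
    obtain _ | j := j
    · obtain rfl : b = 0 := by simpa using hb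
      simp
    rw [LieSubmodule.ucs_succ, LieSubmodule.mem_normalizer]
    intro x
    have leibniz : ⁅x, a * b⁆ = ⁅x, a⁆ * b + a * ⁅x, b⁆ := by
      change (x : A) * (a * b) - a * b * x = (x * a - a * x) * b + a * (x * b - b * x)
      noncomm_ring
    rw [leibniz]
    exact add_mem
      (ih i (j + 1) ((LieSubmodule.mem_normalizer _ _).1 (by rwa [← LieSubmodule.ucs_succ]) x) hb
        (by omega))
      (ih (i + 1) j ha ((LieSubmodule.mem_normalizer _ _).1 (by rwa [← LieSubmodule.ucs_succ]) x)
        (by omega))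

/-- Every Cartan subalgebra `C` of the Lie algebra `A°` associated to an associative `K`-algebra
`A` is closed under the associative multiplication of `A` (hence is an associative
`K`-subalgebra of `A`); if moreover `A` is unital then `1_A ∈ C`, so `C` is a unital
associative subalgebra of `A`. -/
theorem cartanSubalgebra_mul_mem_and_one_mem
    (C : LieSubalgebra K A) (hC : C.IsCartanSubalgebra) :
    (∀ a ∈ C, ∀ b ∈ C, a * b ∈ C) ∧
      ∀ e : A, (∀ x : A, e * x = x ∧ x * e = x) → e ∈ C := by
  constructor
  · intro a ha b hb
    obtain ⟨k, hk⟩ := C.isCartanSubalgebra_iff_isUcsLimit.1 hC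
    rw [← LieSubalgebra.mem_toLieSubmodule, ← hk k le_rfl] at ha hb
    rw [← LieSubalgebra.mem_toLieSubmodule, ← hk (k + k) (by omega)]
    exact mul_mem_ucs_bot_add C k k ha hb
  · intro e he
    rw [← hC.self_normalizing, LieSubalgebra.mem_normalizer_iff]
    intro y _
    have : ⁅e, y⁆ = 0 := by
      change e * y - y * e = 0
      rw [(he y).1, (he y).2, sub_self]
    rw [this]
    exact C.zero_mem

end
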